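/- arXiv:math/0511260 — 3 statements merged into one kernel-verified Lean document; each statement's English description precedes it below -/
import Mathlib

section
/- P maps Z₂(g) onto the subspace (Λ²(A)⊗S²(k)) ⊕ (A⊗Z₂(k)) ⊕ (I_A⊗Λ²(k)), i.e. P(Z₂(g)) = (Λ²(A)⊗S²(k)) ⊕ (A⊗Z₂(k)) ⊕ (I_A⊗Λ²(k)), where Z₂(k) = ker(b_k: Λ²(k) → k). -/
set_option linter.unusedSectionVars false
set_option synthInstance.maxHeartbeats 1000000
set_option maxHeartbeats 1000000
open scoped TensorProduct

namespace CurrentPaper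

variable (K : Type*) [Field K] [CharZero K]

section Wedge

variable (V : Type*) [AddCommGroup V] [Module K V]

/-- `x ∧ y = (1/2)(x ⊗ y - y ⊗ x)` inside `V ⊗ V`. -/
noncomputable def wedge (x y : V) : V ⊗[K] V := (2 : K)⁻¹ • (x ⊗ₜ[K] y - y ⊗ₜ[K] x)

/-- `x ∨ y = (1/2)(x ⊗ y + y ⊗ x)` inside `V ⊗ V`. -/
noncomputable def vee (x y : V) : V ⊗[K] V := (2 : K)⁻¹ • (x ⊗ₜ[K] y + y ⊗ₜ[K] x)

/-- `Λ²(V)` realized as the subspace of skew-symmetric tensors of `V ⊗ V`. -/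
def lambda2 : Submodule K (V ⊗[K] V) := Submodule.span K {t | ∃ x y : V, t = wedge K V x y}

/-- `S²(V)` realized as the subspace of symmetric tensors of `V ⊗ V`. -/
def sym2 : Submodule K (V ⊗[K] V) := Submodule.span K {t | ∃ x y : V, t = vee K V x y}

variable {V}

lemma wedge_mem (x y : V) : wedge K V x y ∈ lambda2 K V := Submodule.subset_span ⟨x, y, rfl⟩

lemma vee_mem (x y : V) : vee K V x y ∈ sym2 K V := Submodule.subset_span ⟨x, y, rfl⟩

end Wedge

section LieRelaxed

variable (L : Type*) [LieRing L] [Module K L]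

/-- `∂(u ∧ v ∧ w) = ⁅u,v⁆ ∧ w + ⁅v,w⁆ ∧ u + ⁅w,u⁆ ∧ v`. -/
noncomputable def dd (u v w : L) : L ⊗[K] L :=
  wedge K L ⁅u, v⁆ w + wedge K L ⁅v, w⁆ u + wedge K L ⁅w, u⁆ v

/-- `B₂(L)`, the space of 2-boundaries, i.e. the image of `∂ : Λ³(L) → Λ²(L)`. -/
def B2 : Submodule K (L ⊗[K] L) := Submodule.span K {t | ∃ u v w : L, t = dd K L u v w}

variable {L}

lemma dd_mem_lambda2 (u v w : L) : dd K L u v w ∈ lambda2 K L :=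
  add_mem (add_mem (wedge_mem K _ _) (wedge_mem K _ _)) (wedge_mem K _ _)

lemma dd_mem_B2 (u v w : L) : dd K L u v w ∈ B2 K L := Submodule.subset_span ⟨u, v, w, rfl⟩

end LieRelaxed

section Lie

variable (L : Type*) [LieRing L] [LieAlgebra K L]

/-- The bracket `b : L ⊗ L → L`, `u ⊗ v ↦ ⁅u,v⁆`, as a linear map. -/
noncomputable def bracketHom : L ⊗[K] L →ₗ[K] L :=
  TensorProduct.lift (LinearMap.mk₂ K (fun u v => ⁅u, v⁆) add_lie smul_lie lie_add lie_smul)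

/-- `Z₂(L) = Λ²(L) ∩ ker b`, the space of 2-cycles. -/
noncomputable def Z2 : Submodule K (L ⊗[K] L) := lambda2 K L ⊓ LinearMap.ker (bracketHom K L)

/-- The derived algebra `L' = [L,L]`, as a subspace of `L`. -/
def derived : Submodule K L := Submodule.span K {m | ∃ u v : L, m = ⁅u, v⁆}

end Lie

section Alg

variable (A : Type*) [CommRing A] [Algebra K A]

/-- `I_A ⊆ S²(A)`: the kernel of the multiplication map `S²(A) → A`. -/
noncomputable def ia : Submodule K (A ⊗[K] A) := sym2 K A ⊓ LinearMap.ker (LinearMap.mul' K A)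

/-- `T(A) ⊆ Λ²(A)`: the span of the elements `ab ∧ c + bc ∧ a + ca ∧ b`. -/
def TA : Submodule K (A ⊗[K] A) :=
  Submodule.span K
    {t | ∃ a b c : A, t = wedge K A (a*b) c + wedge K A (b*c) a + wedge K A (c*a) b}

/-- `T₀(A) ⊆ Λ²(A)`: the span of the elements `ab ∧ c + bc ∧ a + ca ∧ b - abc ∧ 1`. -/
def T0A : Submodule K (A ⊗[K] A) :=
  Submodule.span K
    {t | ∃ a b c : A,
      t = wedge K A (a*b) c + wedge K A (b*c) a + wedge K A (c*a) b - wedge K A (a*b*c) 1}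

variable {A}

lemma TA_el_mem_lambda2 (a b c : A) :
    wedge K A (a*b) c + wedge K A (b*c) a + wedge K A (c*a) b ∈ lambda2 K A :=
  add_mem (add_mem (wedge_mem K _ _) (wedge_mem K _ _)) (wedge_mem K _ _)

lemma T0A_el_mem_lambda2 (a b c : A) :
    wedge K A (a*b) c + wedge K A (b*c) a + wedge K A (c*a) b - wedge K A (a*b*c) 1 ∈
      lambda2 K A :=
  sub_mem (TA_el_mem_lambda2 K a b c) (wedge_mem K _ _)

lemma ia_el_mem (a b : A) : vee K A a b - vee K A (a * b) 1 ∈ ia K A := by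
  refine Submodule.mem_inf.mpr ⟨sub_mem (vee_mem K a b) (vee_mem K _ _), ?_⟩
  simp only [LinearMap.mem_ker, map_sub, vee, map_smul, map_add, LinearMap.mul'_apply,
    mul_one, one_mul, mul_comm b a]
  simp

end Alg

section Current

variable (A : Type*) [CommRing A] [Algebra K A]
variable (k : Type*) [LieRing k] [LieAlgebra K k]

lemma g_smul_lie (c : K) (x y : A ⊗[K] k) : ⁅c • x, y⁆ = c • ⁅x, y⁆ := by
  rw [← algebraMap_smul A c x, ← algebraMap_smul A c ⁅x, y⁆, smul_lie]

lemma g_lie_smul (c : K) (x y : A ⊗[K] k) : ⁅x, c • y⁆ = c • ⁅x, y⁆ := by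
  rw [← algebraMap_smul A c y, ← algebraMap_smul A c ⁅x, y⁆, lie_smul]

/-- The bracket of the current algebra `g = A ⊗ k`, as a `K`-linear map `g ⊗ g → g`. -/
noncomputable def gBracket : (A ⊗[K] k) ⊗[K] (A ⊗[K] k) →ₗ[K] A ⊗[K] k :=
  TensorProduct.lift (LinearMap.mk₂ K (fun u v => ⁅u, v⁆) add_lie
    (fun c x y => g_smul_lie K A k c x y) lie_add (fun c x y => g_lie_smul K A k c x y))

/-- `Z₂(g) = Λ²(g) ∩ ker b` for the current algebra `g = A ⊗ k`. -/
noncomputable def Z2g : Submodule K ((A ⊗[K] k) ⊗[K] (A ⊗[K] k)) :=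
  lambda2 K (A ⊗[K] k) ⊓ LinearMap.ker (gBracket K A k)

/-- The first summand `Λ²(A) ⊗ S²(k)` of the decomposition of `Λ²(A ⊗ k)`. -/
abbrev M1 := (↥(lambda2 K A)) ⊗[K] (↥(sym2 K k))

/-- The second summand `A ⊗ Λ²(k)` of the decomposition of `Λ²(A ⊗ k)`. -/
abbrev M2 := A ⊗[K] (↥(lambda2 K k))

/-- The third summand `I_A ⊗ Λ²(k)` of the decomposition of `Λ²(A ⊗ k)`. -/
abbrev M3 := (↥(ia K A)) ⊗[K] (↥(lambda2 K k))

/-- The target of the isomorphism `P = (p₁,p₂,p₃)`. -/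
abbrev Wspace := M1 K A k × M2 K A k × M3 K A k

variable {A k}

/-- The property characterizing the linear isomorphism
`P = (p₁,p₂,p₃) : Λ²(A ⊗ k) ≅ (Λ²(A) ⊗ S²(k)) ⊕ (A ⊗ Λ²(k)) ⊕ (I_A ⊗ Λ²(k))`:
`p₁(ax ∧ by) = a ∧ b ⊗ x ∨ y`, `p₂(ax ∧ by) = ab ⊗ x ∧ y`,
`p₃(ax ∧ by) = (a ∨ b - ab ∨ 1) ⊗ x ∧ y`. -/
def IsDecomposition (P : ↥(lambda2 K (A ⊗[K] k)) ≃ₗ[K] Wspace K A k) : Prop :=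
  ∀ (a b : A) (x y : k),
    P ⟨wedge K (A ⊗[K] k) (a ⊗ₜ x) (b ⊗ₜ y), wedge_mem K _ _⟩ =
      ((⟨wedge K A a b, wedge_mem K a b⟩ ⊗ₜ[K] ⟨vee K k x y, vee_mem K x y⟩ : M1 K A k),
       ((a * b) ⊗ₜ[K] ⟨wedge K k x y, wedge_mem K x y⟩ : M2 K A k),
       ((⟨vee K A a b - vee K A (a * b) 1, ia_el_mem K a b⟩ ⊗ₜ[K]
          ⟨wedge K k x y, wedge_mem K x y⟩ : M3 K A k)))

end Current

end CurrentPaper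

namespace CurrentPaper

section Wedge

variable (K : Type*) [Field K] [CharZero K] {V : Type*} [AddCommGroup V] [Module K V]

/-- The wedge product `V × V → Λ²(V)` as a bilinear map. -/
noncomputable def wedgeHom : V →ₗ[K] V →ₗ[K] lambda2 K V :=
  LinearMap.mk₂ K (fun x y => ⟨wedge K V x y, wedge_mem K x y⟩)
    (fun x x' y => Subtype.ext <| by
      simp only [wedge, TensorProduct.add_tmul, TensorProduct.tmul_add, Submodule.coe_add]
      module)
    (fun c x y => Subtype.ext <| by
      simp only [wedge, TensorProduct.tmul_smul, ← TensorProduct.smul_tmul', Submodule.coe_smul]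
      module)
    (fun x y y' => Subtype.ext <| by
      simp only [wedge, TensorProduct.add_tmul, TensorProduct.tmul_add, Submodule.coe_add]
      module)
    (fun c x y => Subtype.ext <| by
      simp only [wedge, TensorProduct.tmul_smul, ← TensorProduct.smul_tmul', Submodule.coe_smul]
      module)

lemma wedgeHom_apply (x y : V) : wedgeHom K x y = ⟨wedge K V x y, wedge_mem K x y⟩ := rfl

/-- Linear maps out of `Λ²(V)` are determined by their values on the elements `x ∧ y`. -/
lemma lambda2_hom_ext {W : Type*} [AddCommGroup W] [Module K W] {f g : lambda2 K V →ₗ[K] W}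
    (h : (wedgeHom K).compr₂ f = (wedgeHom K).compr₂ g) : f = g := by
  refine LinearMap.ext fun t => ?_
  obtain ⟨t, ht⟩ := t
  induction ht using Submodule.span_induction with
  | mem t ht =>
    obtain ⟨x, y, rfl⟩ := ht
    exact LinearMap.congr_fun₂ h x y
  | zero => exact (map_zero f).trans (map_zero g).symm
  | add s t hs ht ihs iht =>
    exact (map_add f ⟨s, hs⟩ ⟨t, ht⟩).trans
      ((congrArg₂ (· + ·) ihs iht).trans (map_add g ⟨s, hs⟩ ⟨t, ht⟩).symm)
  | smul c t ht ih =>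
    exact (map_smul f c ⟨t, ht⟩).trans
      ((congrArg (c • ·) ih).trans (map_smul g c ⟨t, ht⟩).symm)

end Wedge

section Current

variable (K : Type*) [Field K] [CharZero K]

/-- The bracket `Λ²(L) → L`, `x ∧ y ↦ ⁅x, y⁆`. -/
noncomputable def lambda2Bracket (L : Type*) [LieRing L] [LieAlgebra K L] :
    lambda2 K L →ₗ[K] L :=
  bracketHom K L ∘ₗ (lambda2 K L).subtype

lemma lambda2Bracket_wedge {L : Type*} [LieRing L] [LieAlgebra K L] (x y : L) :
    lambda2Bracket K L ⟨wedge K L x y, wedge_mem K x y⟩ = ⁅x, y⁆ := by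
  simp only [lambda2Bracket, bracketHom, wedge, LinearMap.comp_apply, Submodule.subtype_apply,
    map_smul, map_sub, TensorProduct.lift.tmul, LinearMap.mk₂_apply]
  rw [← lie_skew x y, neg_sub_left, ← two_smul K, smul_neg, inv_smul_smul₀ two_ne_zero]

variable {A : Type*} [CommRing A] [Algebra K A] {k : Type*} [LieRing k] [LieAlgebra K k]

lemma gBracket_wedge (u v : A ⊗[K] k) : gBracket K A k (wedge K (A ⊗[K] k) u v) = ⁅u, v⁆ := by
  simp only [gBracket, wedge, map_smul, map_sub, TensorProduct.lift.tmul, LinearMap.mk₂_apply]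
  rw [← lie_skew u v, neg_sub_left, ← two_smul K, smul_neg, inv_smul_smul₀ two_ne_zero]

/-- On `Λ²(A ⊗ k)` the bracket of the current algebra is `id ⊗ b_k` after `p₂`. -/
lemma gBracket_eq_lTensor {P : lambda2 K (A ⊗[K] k) ≃ₗ[K] Wspace K A k}
    (hP : IsDecomposition K P) (t : lambda2 K (A ⊗[K] k)) :
    gBracket K A k t = (lambda2Bracket K k).lTensor A (P t).2.1 := by
  suffices h : gBracket K A k ∘ₗ (lambda2 K (A ⊗[K] k)).subtype =
      (lambda2Bracket K k).lTensor A ∘ₗ LinearMap.fst K _ _ ∘ₗ LinearMap.snd K _ _ ∘ₗ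
        P.toLinearMap from LinearMap.congr_fun h t
  refine lambda2_hom_ext K (TensorProduct.ext' fun a x => LinearMap.ext fun v => ?_)
  induction v with
  | zero => simp only [map_zero]
  | add v w hv hw => simp only [map_add, hv, hw]
  | tmul b y =>
    simp [wedgeHom_apply, gBracket_wedge, hP a b x y, lambda2Bracket_wedge]

/-- By flatness of `A`, the kernel of `id ⊗ f` is spanned by the `a ⊗ s` with `s ∈ ker f`. -/
lemma ker_lTensor_eq_span {M N : Type*} [AddCommGroup M] [Module K M] [AddCommGroup N]
    [Module K N] (f : M →ₗ[K] N) :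
    LinearMap.ker (f.lTensor A) =
      Submodule.span K {t : A ⊗[K] M | ∃ (a : A) (s : M), f s = 0 ∧ t = a ⊗ₜ[K] s} := by
  refine le_antisymm (fun t ht => ?_) (Submodule.span_le.mpr ?_)
  · obtain ⟨s, rfl⟩ := (Module.Flat.lTensor_exact A
      (LinearMap.exact_subtype_ker_map f) t).mp ht
    clear ht
    induction s with
    | zero => simp
    | add s s' hs hs' => simpa only [map_add] using add_mem hs hs'
    | tmul a s => exact Submodule.subset_span ⟨a, s, s.2, rfl⟩
  · rintro _ ⟨a, s, hs, rfl⟩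
    simp [hs]

end Current

/-- `P` maps `Z₂(g)` onto
`(Λ²(A) ⊗ S²(k)) ⊕ (A ⊗ Z₂(k)) ⊕ (I_A ⊗ Λ²(k))`. -/
theorem statement1 (K : Type*) [Field K] [CharZero K]
    (A : Type*) [CommRing A] [Algebra K A]
    (k : Type*) [LieRing k] [LieAlgebra K k]
    (P : ↥(lambda2 K (A ⊗[K] k)) ≃ₗ[K] Wspace K A k) (hP : IsDecomposition K P) :
    Submodule.map (P.toLinearMap.comp
        ((Z2g K A k).comap (lambda2 K (A ⊗[K] k)).subtype).subtype) ⊤ =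
      (⊤ : Submodule K (M1 K A k)).prod
        ((Submodule.span K {t : M2 K A k | ∃ (a : A) (s : ↥(lambda2 K k)),
            (s : k ⊗[K] k) ∈ Z2 K k ∧ t = a ⊗ₜ[K] s}).prod
          (⊤ : Submodule K (M3 K A k))) := by
  have hZ (s : lambda2 K k) : (s : k ⊗[K] k) ∈ Z2 K k ↔ lambda2Bracket K k s = 0 :=
    and_iff_right s.2
  have hZg (t : lambda2 K (A ⊗[K] k)) :
      (t : (A ⊗[K] k) ⊗[K] (A ⊗[K] k)) ∈ Z2g K A k ↔
        (lambda2Bracket K k).lTensor A (P t).2.1 = 0 := by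
    rw [← gBracket_eq_lTensor K hP]
    exact and_iff_right t.2
  simp only [hZ, ← ker_lTensor_eq_span]
  ext w
  simp only [Submodule.map_comp, Submodule.map_subtype_top, Submodule.mem_prod,
    Submodule.mem_top, true_and, and_true, LinearMap.mem_ker]
  constructor
  · rintro ⟨t, ht, rfl⟩
    exact (hZg t).mp ht
  · intro hw
    exact ⟨P.symm w, (hZg _).mpr (by simpa using hw), P.apply_symm_apply w⟩

end CurrentPaper
end

section
/- For all a,b,c ∈ A and x,y,z ∈ k one has, modulo B₂(g) (where p₁, p₂ are regarded as maps Λ²(g) → Λ²(g) via the isomorphism P): p₁(∂(ax∧by∧cz)) ≡ p₁(abc·x ∧ [y,z]) ≡ −p₂(∂(ax∧by∧cz)) mod B₂(g). In particular (p₁+p₂)(B₂(g)) ⊆ B₂(g). -/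
set_option linter.unusedSectionVars false
set_option synthInstance.maxHeartbeats 1000000
set_option maxHeartbeats 1000000
open scoped TensorProduct

namespace CurrentPaper

variable (K : Type*) [Field K] [CharZero K]
variable (A : Type*) [CommRing A] [Algebra K A]
variable (k : Type*) [LieRing k] [LieAlgebra K k]

/-- `p₁`, regarded as a map `Λ²(g) → Λ²(g)` via the isomorphism `P` (valued in `g ⊗ g`). -/
noncomputable def q1 (P : ↥(lambda2 K (A ⊗[K] k)) ≃ₗ[K] Wspace K A k)
    (t : ↥(lambda2 K (A ⊗[K] k))) : (A ⊗[K] k) ⊗[K] (A ⊗[K] k) :=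
  (P.symm ((P t).1, 0, 0) : ↥(lambda2 K (A ⊗[K] k)))

/-- `p₂`, regarded as a map `Λ²(g) → Λ²(g)` via the isomorphism `P` (valued in `g ⊗ g`). -/
noncomputable def q2 (P : ↥(lambda2 K (A ⊗[K] k)) ≃ₗ[K] Wspace K A k)
    (t : ↥(lambda2 K (A ⊗[K] k))) : (A ⊗[K] k) ⊗[K] (A ⊗[K] k) :=
  (P.symm (0, (P t).2.1, 0) : ↥(lambda2 K (A ⊗[K] k)))

section CyclicRelation

variable {K A}
variable {M : Type*} [AddCommGroup M]

lemma cyclic_flip {fx fy fz : A → A → M}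
    (R : ∀ u v w, fz w (u * v) + fx u (v * w) + fy v (w * u) = 0) (v w : A) :
    fz v w + fz w v = fz 1 (v * w) - fx 1 (v * w) - fy 1 (v * w) := by
  have h1 := R 1 w v
  have h2 := R v w 1
  have h3 := R v 1 w
  simp only [one_mul, mul_one, mul_comm w v] at h1 h2 h3
  linear_combination (norm := module) h1 - h2 + h3

lemma cyclic_one {fx fy fz : A → A → M}
    (R : ∀ u v w, fz w (u * v) + fx u (v * w) + fy v (w * u) = 0) (m : A) :
    fx m 1 = - fy 1 m - fz 1 m := by
  have h := R m 1 1
  simp only [one_mul, mul_one] at h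
  linear_combination (norm := module) h

lemma cyclic_rotate {fx fy fz : A → A → M}
    (R : ∀ u v w, fz w (u * v) + fx u (v * w) + fy v (w * u) = 0) (u v w : A) :
    fx w (u * v) + fy u (v * w) + fz v (w * u) = 0 := by
  linear_combination (norm := module) R w u v

lemma cyclic_sum {fx fy fz : A → A → M}
    (R : ∀ u v w, fz w (u * v) + fx u (v * w) + fy v (w * u) = 0) (a b c : A) :
    fz (a * b) c + fx (b * c) a + fy (c * a) b = fx (a * b * c) 1 - fx 1 (a * b * c) := by
  have hz := cyclic_flip R (a * b) c
  have hx := cyclic_flip (cyclic_rotate R) (b * c) a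
  have hy := cyclic_flip (cyclic_rotate (cyclic_rotate R)) (c * a) b
  have h1 := cyclic_one R (a * b * c)
  rw [show b * c * a = a * b * c by ring] at hx
  rw [show c * a * b = a * b * c by ring] at hy
  linear_combination (norm := module) hz + hx + hy - R a b c - h1

lemma cyclic_sum_one {fx fy fz : A → A → M}
    (R : ∀ u v w, fz w (u * v) + fx u (v * w) + fy v (w * u) = 0) (m : A) :
    fx m 1 - fx 1 m = (fz m 1 + fz 1 m) + (fx m 1 + fx 1 m) + (fy m 1 + fy 1 m) := by
  linear_combination (norm := module)
    - cyclic_one (cyclic_rotate R) m - cyclic_one (cyclic_rotate (cyclic_rotate R)) m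

end CyclicRelation

section WedgeLinear

variable {V : Type*} [AddCommGroup V] [Module K V]

lemma wedge_swap (x y : V) : wedge K V x y = - wedge K V y x := by
  simp only [wedge]; module

lemma vee_swap (x y : V) : vee K V x y = vee K V y x := by
  simp only [vee]; module

lemma wedge_add_left (x x' y : V) : wedge K V (x + x') y = wedge K V x y + wedge K V x' y := by
  simp only [wedge, TensorProduct.add_tmul, TensorProduct.tmul_add]; module

lemma wedge_add_right (x y y' : V) : wedge K V x (y + y') = wedge K V x y + wedge K V x y' := by
  simp only [wedge, TensorProduct.add_tmul, TensorProduct.tmul_add]; module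

lemma wedge_zero_left (y : V) : wedge K V 0 y = 0 := by simp [wedge]

lemma wedge_zero_right (x : V) : wedge K V x 0 = 0 := by simp [wedge]

end WedgeLinear

/-- `B₂(A ⊗ k)` is spanned by the boundaries of pure tensors. -/
lemma B2_le_of_tmul {N : Submodule K ((A ⊗[K] k) ⊗[K] (A ⊗[K] k))}
    (h : ∀ (a b c : A) (x y z : k),
      dd K (A ⊗[K] k) (a ⊗ₜ x) (b ⊗ₜ y) (c ⊗ₜ z) ∈ N) : B2 K (A ⊗[K] k) ≤ N := by
  refine Submodule.span_le.mpr ?_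
  rintro _ ⟨u, v, w, rfl⟩
  have zero_of {t : (A ⊗[K] k) ⊗[K] (A ⊗[K] k)} (ht : t = 0) : t ∈ N := ht ▸ N.zero_mem
  have add_of {t t₁ t₂ : (A ⊗[K] k) ⊗[K] (A ⊗[K] k)} (h₁ : t₁ ∈ N) (h₂ : t₂ ∈ N)
      (ht : t = t₁ + t₂) : t ∈ N := ht ▸ N.add_mem h₁ h₂
  change dd K (A ⊗[K] k) u v w ∈ N
  induction u with
  | zero => exact zero_of (by simp [dd, wedge_zero_left, wedge_zero_right])
  | add u u' hu hu' =>
    refine add_of hu hu' ?_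
    simp only [dd, add_lie, lie_add, wedge_add_left, wedge_add_right]; abel
  | tmul a x =>
    induction v with
    | zero => exact zero_of (by simp [dd, wedge_zero_left, wedge_zero_right])
    | add v v' hv hv' =>
      refine add_of hv hv' ?_
      simp only [dd, add_lie, lie_add, wedge_add_left, wedge_add_right]; abel
    | tmul b y =>
      induction w with
      | zero => exact zero_of (by simp [dd, wedge_zero_left, wedge_zero_right])
      | add w w' hw hw' =>
        refine add_of hw hw' ?_
        simp only [dd, add_lie, lie_add, wedge_add_left, wedge_add_right]; abel
      | tmul c z => exact h a b c x y z

lemma dd_tmul (a b c : A) (x y z : k) :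
    dd K (A ⊗[K] k) (a ⊗ₜ x) (b ⊗ₜ y) (c ⊗ₜ z) =
      wedge K (A ⊗[K] k) ((a * b) ⊗ₜ ⁅x, y⁆) (c ⊗ₜ z) +
      wedge K (A ⊗[K] k) ((b * c) ⊗ₜ ⁅y, z⁆) (a ⊗ₜ x) +
      wedge K (A ⊗[K] k) ((c * a) ⊗ₜ ⁅z, x⁆) (b ⊗ₜ y) := by
  simp only [dd, LieAlgebra.ExtendScalars.bracket_tmul]

section Projections

variable (P : ↥(lambda2 K (A ⊗[K] k)) ≃ₗ[K] Wspace K A k)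

lemma q1_add (s t : ↥(lambda2 K (A ⊗[K] k))) :
    q1 K A k P (s + t) = q1 K A k P s + q1 K A k P t := by
  simp only [q1, map_add, Prod.fst_add, ← Submodule.coe_add]
  simp only [← map_add, Prod.mk_add_mk, add_zero]

lemma q2_add (s t : ↥(lambda2 K (A ⊗[K] k))) :
    q2 K A k P (s + t) = q2 K A k P s + q2 K A k P t := by
  simp only [q2, map_add, Prod.fst_add, Prod.snd_add, ← Submodule.coe_add]
  simp only [← map_add, Prod.mk_add_mk, add_zero]

lemma q1_smul (r : K) (t : ↥(lambda2 K (A ⊗[K] k))) :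
    q1 K A k P (r • t) = r • q1 K A k P t := by
  simp only [q1, map_smul, Prod.smul_fst, ← Submodule.coe_smul]
  simp only [← map_smul, Prod.smul_mk, smul_zero]

lemma q2_smul (r : K) (t : ↥(lambda2 K (A ⊗[K] k))) :
    q2 K A k P (r • t) = r • q2 K A k P t := by
  simp only [q2, map_smul, Prod.smul_fst, Prod.smul_snd, ← Submodule.coe_smul]
  simp only [← map_smul, Prod.smul_mk, smul_zero]

variable {P}

lemma q1_wedge (hP : IsDecomposition K P) (a b : A) (x y : k) :
    q1 K A k P ⟨wedge K (A ⊗[K] k) (a ⊗ₜ x) (b ⊗ₜ y), wedge_mem K _ _⟩ =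
      (2 : K)⁻¹ • (wedge K (A ⊗[K] k) (a ⊗ₜ x) (b ⊗ₜ y) +
        wedge K (A ⊗[K] k) (a ⊗ₜ y) (b ⊗ₜ x)) := by
  have hw : (⟨wedge K k y x, wedge_mem K y x⟩ : lambda2 K k) = -⟨wedge K k x y, wedge_mem K x y⟩ :=
    Subtype.ext (wedge_swap K y x)
  have hv : (⟨vee K k y x, vee_mem K y x⟩ : sym2 K k) = ⟨vee K k x y, vee_mem K x y⟩ :=
    Subtype.ext (vee_swap K y x)
  have key : P.symm ((P ⟨wedge K (A ⊗[K] k) (a ⊗ₜ x) (b ⊗ₜ y), wedge_mem K _ _⟩).1, 0, 0) =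
      (2 : K)⁻¹ • (⟨wedge K (A ⊗[K] k) (a ⊗ₜ x) (b ⊗ₜ y), wedge_mem K _ _⟩ +
        ⟨wedge K (A ⊗[K] k) (a ⊗ₜ y) (b ⊗ₜ x), wedge_mem K _ _⟩) := by
    rw [LinearEquiv.symm_apply_eq, map_smul, map_add, hP, hP, hw, hv]
    refine Prod.ext ?_ (Prod.ext ?_ ?_)
    · simp only [Prod.smul_fst, Prod.fst_add]; module
    · simp only [Prod.smul_snd, Prod.smul_fst, Prod.fst_add, Prod.snd_add, TensorProduct.tmul_neg]
      module
    · simp only [Prod.smul_snd, Prod.snd_add, TensorProduct.tmul_neg]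
      module
  exact congrArg Subtype.val key

lemma q2_wedge (hP : IsDecomposition K P) (a b : A) (x y : k) :
    q2 K A k P ⟨wedge K (A ⊗[K] k) (a ⊗ₜ x) (b ⊗ₜ y), wedge_mem K _ _⟩ =
      (2 : K)⁻¹ • (wedge K (A ⊗[K] k) ((a * b) ⊗ₜ x) ((1 : A) ⊗ₜ y) -
        wedge K (A ⊗[K] k) ((a * b) ⊗ₜ y) ((1 : A) ⊗ₜ x)) := by
  have hw : (⟨wedge K k y x, wedge_mem K y x⟩ : lambda2 K k) = -⟨wedge K k x y, wedge_mem K x y⟩ :=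
    Subtype.ext (wedge_swap K y x)
  have hv : (⟨vee K k y x, vee_mem K y x⟩ : sym2 K k) = ⟨vee K k x y, vee_mem K x y⟩ :=
    Subtype.ext (vee_swap K y x)
  have hi : (⟨vee K A (a * b) 1 - vee K A (a * b * 1) 1, ia_el_mem K (a * b) 1⟩ : ia K A) = 0 :=
    Subtype.ext (by simp)
  have key : P.symm (0, (P ⟨wedge K (A ⊗[K] k) (a ⊗ₜ x) (b ⊗ₜ y), wedge_mem K _ _⟩).2.1, 0) =
      (2 : K)⁻¹ • (⟨wedge K (A ⊗[K] k) ((a * b) ⊗ₜ x) ((1 : A) ⊗ₜ y), wedge_mem K _ _⟩ +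
        (-1 : K) • ⟨wedge K (A ⊗[K] k) ((a * b) ⊗ₜ y) ((1 : A) ⊗ₜ x), wedge_mem K _ _⟩) := by
    rw [LinearEquiv.symm_apply_eq, map_smul, map_add, map_smul, hP, hP, hP, hw, hv, hi]
    refine Prod.ext ?_ (Prod.ext ?_ ?_)
    · simp only [Prod.smul_fst, Prod.fst_add]; module
    · simp only [Prod.smul_snd, Prod.smul_fst, Prod.fst_add, Prod.snd_add, TensorProduct.tmul_neg,
        mul_one]
      module
    · simp
  refine (congrArg Subtype.val key).trans ?_
  simp only [Submodule.coe_smul, Submodule.coe_add]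
  module

end Projections

lemma dd_tmul_subtype (a b c : A) (x y z : k) :
    (⟨dd K (A ⊗[K] k) (a ⊗ₜ x) (b ⊗ₜ y) (c ⊗ₜ z), dd_mem_lambda2 K _ _ _⟩ :
        lambda2 K (A ⊗[K] k)) =
      ⟨wedge K (A ⊗[K] k) ((a * b) ⊗ₜ ⁅x, y⁆) (c ⊗ₜ z), wedge_mem K _ _⟩ +
      ⟨wedge K (A ⊗[K] k) ((b * c) ⊗ₜ ⁅y, z⁆) (a ⊗ₜ x), wedge_mem K _ _⟩ +
      ⟨wedge K (A ⊗[K] k) ((c * a) ⊗ₜ ⁅z, x⁆) (b ⊗ₜ y), wedge_mem K _ _⟩ :=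
  Subtype.ext (dd_tmul K A k a b c x y z)

/-- The class of `ux ∧ vw` in `Λ²(g) / B₂(g)`. -/
noncomputable def wedgeClass (x w : k) (u v : A) :
    ((A ⊗[K] k) ⊗[K] (A ⊗[K] k)) ⧸ B2 K (A ⊗[K] k) :=
  (B2 K (A ⊗[K] k)).mkQ (wedge K (A ⊗[K] k) (u ⊗ₜ x) (v ⊗ₜ w))

lemma wedgeClass_cyclic (x y z : k) (u v w : A) :
    wedgeClass K A k z ⁅x, y⁆ w (u * v) + wedgeClass K A k x ⁅y, z⁆ u (v * w) +
      wedgeClass K A k y ⁅z, x⁆ v (w * u) = 0 := by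
  have h := dd_mem_B2 K (u ⊗ₜ[K] x) (v ⊗ₜ[K] y) (w ⊗ₜ[K] z)
  rw [dd_tmul, wedge_swap, wedge_swap K (_ ⊗ₜ ⁅y, z⁆), wedge_swap K (_ ⊗ₜ ⁅z, x⁆),
    ← Submodule.neg_mem_iff] at h
  simp only [wedgeClass, ← map_add]
  rw [Submodule.mkQ_apply, Submodule.Quotient.mk_eq_zero]
  convert h using 1
  abel

/-- For all `a,b,c ∈ A` and `x,y,z ∈ k` one has, modulo `B₂(g)`:
`p₁(∂(ax ∧ by ∧ cz)) ≡ p₁(abc·x ∧ [y,z]) ≡ -p₂(∂(ax ∧ by ∧ cz))`.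
In particular `(p₁ + p₂)(B₂(g)) ⊆ B₂(g)`. -/
theorem statement2
    (P : ↥(lambda2 K (A ⊗[K] k)) ≃ₗ[K] Wspace K A k) (hP : IsDecomposition K P) :
    (∀ (a b c : A) (x y z : k),
      q1 K A k P ⟨dd K (A ⊗[K] k) (a ⊗ₜ x) (b ⊗ₜ y) (c ⊗ₜ z), dd_mem_lambda2 K _ _ _⟩ -
          q1 K A k P ⟨wedge K (A ⊗[K] k) ((a * b * c) ⊗ₜ x) ((1 : A) ⊗ₜ ⁅y, z⁆),
            wedge_mem K _ _⟩ ∈ B2 K (A ⊗[K] k) ∧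
      q1 K A k P ⟨wedge K (A ⊗[K] k) ((a * b * c) ⊗ₜ x) ((1 : A) ⊗ₜ ⁅y, z⁆),
            wedge_mem K _ _⟩ +
          q2 K A k P ⟨dd K (A ⊗[K] k) (a ⊗ₜ x) (b ⊗ₜ y) (c ⊗ₜ z), dd_mem_lambda2 K _ _ _⟩ ∈
        B2 K (A ⊗[K] k)) ∧
    ∀ t : ↥(lambda2 K (A ⊗[K] k)), (t : (A ⊗[K] k) ⊗[K] (A ⊗[K] k)) ∈ B2 K (A ⊗[K] k) →
      q1 K A k P t + q2 K A k P t ∈ B2 K (A ⊗[K] k) := by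
  have main : ∀ (a b c : A) (x y z : k),
      q1 K A k P ⟨dd K (A ⊗[K] k) (a ⊗ₜ x) (b ⊗ₜ y) (c ⊗ₜ z), dd_mem_lambda2 K _ _ _⟩ -
          q1 K A k P ⟨wedge K (A ⊗[K] k) ((a * b * c) ⊗ₜ x) ((1 : A) ⊗ₜ ⁅y, z⁆),
            wedge_mem K _ _⟩ ∈ B2 K (A ⊗[K] k) ∧
      q1 K A k P ⟨wedge K (A ⊗[K] k) ((a * b * c) ⊗ₜ x) ((1 : A) ⊗ₜ ⁅y, z⁆),
            wedge_mem K _ _⟩ +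
          q2 K A k P ⟨dd K (A ⊗[K] k) (a ⊗ₜ x) (b ⊗ₜ y) (c ⊗ₜ z), dd_mem_lambda2 K _ _ _⟩ ∈
        B2 K (A ⊗[K] k) := by
    intro a b c x y z
    have R := wedgeClass_cyclic K A k x y z
    have h₀ := R a b c
    have h₁ := cyclic_sum R a b c
    have h₂ := cyclic_sum_one R (a * b * c)
    simp only [wedgeClass] at h₀ h₁ h₂
    rw [dd_tmul_subtype]
    simp only [q1_add, q2_add, q1_wedge K A k hP, q2_wedge K A k hP,
      show b * c * a = a * b * c by ring, show c * a * b = a * b * c by ring]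
    simp only [wedge_swap K (_ ⊗ₜ ⁅_, _⁆)]
    constructor
    · rw [← Submodule.Quotient.mk_eq_zero, ← Submodule.mkQ_apply]
      simp only [map_add, map_sub, map_smul, map_neg]
      linear_combination (norm := module) (2 : K)⁻¹ • h₁ - (2 : K)⁻¹ • h₀
    · rw [← Submodule.Quotient.mk_eq_zero, ← Submodule.mkQ_apply]
      simp only [map_add, map_sub, map_smul, map_neg]
      linear_combination (norm := module) (2 : K)⁻¹ • h₂
  refine ⟨main, fun t ht => ?_⟩
  let φ : lambda2 K (A ⊗[K] k) →ₗ[K] (A ⊗[K] k) ⊗[K] (A ⊗[K] k) :=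
    { toFun := fun t => q1 K A k P t + q2 K A k P t
      map_add' := fun s t => by rw [q1_add, q2_add]; abel
      map_smul' := fun r t => by rw [q1_smul, q2_smul, RingHom.id_apply, smul_add] }
  have hle : B2 K (A ⊗[K] k) ≤
      ((B2 K (A ⊗[K] k)).comap φ).map (lambda2 K (A ⊗[K] k)).subtype := by
    refine B2_le_of_tmul K A k fun a b c x y z => ⟨⟨_, dd_mem_lambda2 K _ _ _⟩, ?_, rfl⟩
    obtain ⟨h₁, h₂⟩ := main a b c x y z
    change q1 K A k P _ + q2 K A k P _ ∈ B2 K (A ⊗[K] k)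
    convert add_mem h₁ h₂ using 1
    abel
  obtain ⟨s, hs, hst⟩ := hle ht
  rwa [Subtype.ext hst] at hs

end CurrentPaper
end

section
/- p₂(B₂(g)) = A ⊗ B₂(k), where B₂(k) = im(∂: Λ³(k) → Λ²(k)). -/
set_option linter.unusedSectionVars false
set_option synthInstance.maxHeartbeats 1000000
set_option maxHeartbeats 1000000
open scoped TensorProduct

namespace CurrentPaper

section Multilinearity

variable (K : Type*) [Field K] (L : Type*) [LieRing L] [Module K L]

lemma dd_rotate (u v w : L) : dd K L u v w = dd K L v w u := by
  simp only [dd]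
  abel

lemma dd_add_left (u u' v w : L) : dd K L (u + u') v w = dd K L u v w + dd K L u' v w := by
  simp only [dd, wedge, add_lie, lie_add, TensorProduct.add_tmul, TensorProduct.tmul_add]
  module

lemma dd_zero_left (v w : L) : dd K L 0 v w = 0 := by
  simp [dd, wedge]

variable {K L}

/-- A subspace containing `∂(u ∧ v ∧ w)` for `u`, `v`, `w` in an additively generating set
contains all of `B₂(L)`. -/
lemma B2_le_of_closure_eq_top {S : Set L} (hS : AddSubmonoid.closure S = ⊤)
    {N : Submodule K (L ⊗[K] L)}
    (hN : ∀ u ∈ S, ∀ v ∈ S, ∀ w ∈ S, dd K L u v w ∈ N) : B2 K L ≤ N := by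
  have extend_left : ∀ v w, (∀ u ∈ S, dd K L u v w ∈ N) → ∀ u, dd K L u v w ∈ N := by
    intro v w h u
    have hu : u ∈ AddSubmonoid.closure S := hS ▸ AddSubmonoid.mem_top u
    induction hu using AddSubmonoid.closure_induction with
    | mem u hu => exact h u hu
    | zero => rw [dd_zero_left]; exact N.zero_mem
    | add u u' _ _ hu hu' => rw [dd_add_left]; exact N.add_mem hu hu'
  refine Submodule.span_le.mpr ?_
  rintro _ ⟨u, v, w, rfl⟩
  refine extend_left v w (fun u hu => ?_) u
  rw [dd_rotate]
  refine extend_left w u (fun v hv => ?_) v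
  rw [dd_rotate]
  refine extend_left u v (fun w hw => ?_) w
  rw [dd_rotate]
  exact hN u hu v hv w hw

end Multilinearity

section SecondComponent

variable {K : Type*} [Field K] [CharZero K] {A : Type*} [CommRing A] [Algebra K A]
  {k : Type*} [LieRing k] [LieAlgebra K k]

/-- On pure tensors, `p₂(∂(ax ∧ by ∧ cz)) = abc ⊗ ∂(x ∧ y ∧ z)`. -/
lemma apply_dd_tmul (q : lambda2 K (A ⊗[K] k) →ₗ[K] M2 K A k)
    (hq : ∀ (a b : A) (x y : k), q ⟨wedge K (A ⊗[K] k) (a ⊗ₜ x) (b ⊗ₜ y), wedge_mem K _ _⟩ =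
      (a * b) ⊗ₜ[K] ⟨wedge K k x y, wedge_mem K x y⟩)
    (a b c : A) (x y z : k) :
    q ⟨dd K (A ⊗[K] k) (a ⊗ₜ x) (b ⊗ₜ y) (c ⊗ₜ z), dd_mem_lambda2 K _ _ _⟩ =
      (a * b * c) ⊗ₜ[K] ⟨dd K k x y z, dd_mem_lambda2 K x y z⟩ := by
  have hg : (⟨dd K (A ⊗[K] k) (a ⊗ₜ x) (b ⊗ₜ y) (c ⊗ₜ z), dd_mem_lambda2 K _ _ _⟩ :
        lambda2 K (A ⊗[K] k)) =
      ⟨wedge K (A ⊗[K] k) ((a * b) ⊗ₜ ⁅x, y⁆) (c ⊗ₜ z), wedge_mem K _ _⟩ +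
      ⟨wedge K (A ⊗[K] k) ((b * c) ⊗ₜ ⁅y, z⁆) (a ⊗ₜ x), wedge_mem K _ _⟩ +
      ⟨wedge K (A ⊗[K] k) ((c * a) ⊗ₜ ⁅z, x⁆) (b ⊗ₜ y), wedge_mem K _ _⟩ := by
    apply Subtype.ext
    simp only [dd, LieAlgebra.ExtendScalars.bracket_tmul, Submodule.coe_add]
  have hk : (⟨dd K k x y z, dd_mem_lambda2 K x y z⟩ : lambda2 K k) =
      ⟨wedge K k ⁅x, y⁆ z, wedge_mem K _ _⟩ + ⟨wedge K k ⁅y, z⁆ x, wedge_mem K _ _⟩ +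
      ⟨wedge K k ⁅z, x⁆ y, wedge_mem K _ _⟩ := rfl
  have h₁ : b * c * a = a * b * c := by ring
  have h₂ : c * a * b = a * b * c := by ring
  rw [hg, hk, map_add, map_add, hq, hq, hq, h₁, h₂, TensorProduct.tmul_add,
    TensorProduct.tmul_add]

lemma map_comap_B2_eq_span (q : lambda2 K (A ⊗[K] k) →ₗ[K] M2 K A k)
    (hq : ∀ (a b : A) (x y : k), q ⟨wedge K (A ⊗[K] k) (a ⊗ₜ x) (b ⊗ₜ y), wedge_mem K _ _⟩ =
      (a * b) ⊗ₜ[K] ⟨wedge K k x y, wedge_mem K x y⟩) :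
    Submodule.map q ((B2 K (A ⊗[K] k)).comap (lambda2 K (A ⊗[K] k)).subtype) =
      Submodule.span K {t : M2 K A k | ∃ (a : A) (s : ↥(lambda2 K k)),
        (s : k ⊗[K] k) ∈ B2 K k ∧ t = a ⊗ₜ[K] s} := by
  set R : Submodule K (M2 K A k) := Submodule.span K {t : M2 K A k | ∃ (a : A)
    (s : ↥(lambda2 K k)), (s : k ⊗[K] k) ∈ B2 K k ∧ t = a ⊗ₜ[K] s}
  set Q := Submodule.map q ((B2 K (A ⊗[K] k)).comap (lambda2 K (A ⊗[K] k)).subtype)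
  apply le_antisymm
  · have key : B2 K (A ⊗[K] k) ≤ (R.comap q).map (lambda2 K (A ⊗[K] k)).subtype := by
      refine B2_le_of_closure_eq_top
        (S := {t : A ⊗[K] k | ∃ a x, a ⊗ₜ[K] x = t}) ?_ ?_
      · refine eq_top_iff.mpr fun t _ => ?_
        induction t with
        | zero => exact AddSubmonoid.zero_mem _
        | tmul a x => exact AddSubmonoid.subset_closure ⟨a, x, rfl⟩
        | add t t' ht ht' =>
          exact AddSubmonoid.add_mem _ (ht trivial) (ht' trivial)
      · rintro _ ⟨a, x, rfl⟩ _ ⟨b, y, rfl⟩ _ ⟨c, z, rfl⟩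
        refine ⟨⟨_, dd_mem_lambda2 K _ _ _⟩, ?_, rfl⟩
        rw [SetLike.mem_coe, Submodule.mem_comap, apply_dd_tmul q hq]
        exact Submodule.subset_span ⟨_, _, dd_mem_B2 K x y z, rfl⟩
    rintro _ ⟨t, ht, rfl⟩
    obtain ⟨t', ht', h⟩ := key ht
    rwa [← Subtype.ext h]
  · refine Submodule.span_le.mpr ?_
    rintro _ ⟨a, s, hs, rfl⟩
    have key : B2 K k ≤ (Q.comap (TensorProduct.mk K A (lambda2 K k) a)).map
        (lambda2 K k).subtype := by
      refine Submodule.span_le.mpr ?_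
      rintro _ ⟨x, y, z, rfl⟩
      refine ⟨⟨_, dd_mem_lambda2 K _ _ _⟩, ?_, rfl⟩
      refine ⟨⟨_, dd_mem_lambda2 K (a ⊗ₜ x) (1 ⊗ₜ y) (1 ⊗ₜ z)⟩, dd_mem_B2 K _ _ _, ?_⟩
      rw [apply_dd_tmul q hq, mul_one, mul_one, TensorProduct.mk_apply]
    obtain ⟨s', hs', h⟩ := key hs
    rw [← Subtype.ext h]
    exact hs'

end SecondComponent

/-- `p₂(B₂(g)) = A ⊗ B₂(k)`. -/
theorem statement4 (K : Type*) [Field K] [CharZero K]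
    (A : Type*) [CommRing A] [Algebra K A]
    (k : Type*) [LieRing k] [LieAlgebra K k]
    (P : ↥(lambda2 K (A ⊗[K] k)) ≃ₗ[K] Wspace K A k) (hP : IsDecomposition K P) :
    Submodule.map ((LinearMap.fst K (M2 K A k) (M3 K A k)).comp
        ((LinearMap.snd K (M1 K A k) (M2 K A k × M3 K A k)).comp P.toLinearMap))
        ((B2 K (A ⊗[K] k)).comap (lambda2 K (A ⊗[K] k)).subtype) =
      Submodule.span K {t : M2 K A k | ∃ (a : A) (s : ↥(lambda2 K k)),
        (s : k ⊗[K] k) ∈ B2 K k ∧ t = a ⊗ₜ[K] s} := by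
  refine map_comap_B2_eq_span _ fun a b x y => ?_
  simp only [LinearMap.comp_apply, LinearEquiv.coe_coe, hP a b x y, LinearMap.snd_apply,
    LinearMap.fst_apply]

end CurrentPaper
end
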